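/- Let C ≥ 0, let u_n : ℝ → ℝ (n ∈ ℕ) and u : ℝ → ℝ be continuous functions, each semiconcave with constant C, i.e. g(x+h) + g(x−h) − 2 g(x) ≤ C h² for all x ∈ ℝ, h > 0, for g = u_n and g = u. Suppose u_n converges to u uniformly on ℝ. If x ∈ ℝ is a point at which every u_n and u are differentiable, then the derivatives converge: u_n′(x) → u′(x) as n → ∞. -/

import Mathlib

lemma small_of_hasDerivAt {g : ℝ → ℝ} {x d : ℝ} (hg : HasDerivAt g d x) {ε : ℝ} (hε : 0 < ε) :
    ∃ δ > 0, ∀ s : ℝ, |s| < δ → |g (x + s) - g x - s * d| ≤ ε * |s| := by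
  have h := (hasDerivAt_iff_isLittleO_nhds_zero.1 hg).def hε
  obtain ⟨δ, hδ, h⟩ := Metric.eventually_nhds_iff.1 h
  refine ⟨δ, hδ, fun s hs => ?_⟩
  have := h (y := s) (by simpa [Real.dist_eq] using hs)
  simpa [Real.norm_eq_abs] using this

lemma upper_of_semiconcave {g : ℝ → ℝ} {C x d : ℝ} (hC : 0 ≤ C)
    (hsc : ∀ (x h : ℝ), 0 < h → g (x + h) + g (x - h) - 2 * g x ≤ C * h ^ 2)
    (hg : HasDerivAt g d x) (t : ℝ) :
    g (x + t) - g x - t * d ≤ C * t ^ 2 / 2 := by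
  have key : ∀ t : ℝ, g (x + t) + g x - 2 * g (x + t / 2) ≤ C * (t / 2) ^ 2 := by
    intro t
    rcases lt_trichotomy t 0 with h | h | h
    · have := hsc (x + t / 2) (-(t / 2)) (by linarith)
      rw [show x + t / 2 + -(t / 2) = x by ring, show x + t / 2 - -(t / 2) = x + t by ring] at this
      nlinarith
    · subst h
      simp
      linarith
    · have := hsc (x + t / 2) (t / 2) (by linarith)
      rw [show x + t / 2 + t / 2 = x + t by ring, show x + t / 2 - t / 2 = x by ring] at this
      nlinarith
  have iter : ∀ n : ℕ, g (x + t) - g x - t * d - C * t ^ 2 / 2 ≤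
      2 ^ n * (g (x + t / 2 ^ n) - g x - t / 2 ^ n * d - C * (t / 2 ^ n) ^ 2 / 2) := by
    intro n
    induction n with
    | zero => simp
    | succ n ih =>
      refine ih.trans ?_
      have e : t / 2 ^ (n + 1) = t / 2 ^ n / 2 := by rw [pow_succ, div_div]
      rw [e, pow_succ (2 : ℝ) n, mul_assoc]
      have := key (t / 2 ^ n)
      apply mul_le_mul_of_nonneg_left _ (by positivity)
      nlinarith
  apply le_of_forall_pos_le_add
  intro ε hε
  obtain ⟨δ, hδ, hs⟩ := small_of_hasDerivAt hg (ε := ε / (|t| + 1)) (by positivity)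
  obtain ⟨n, hn⟩ := pow_unbounded_of_one_lt (|t| / δ) (one_lt_two (α := ℝ))
  have hp : (0 : ℝ) < 2 ^ n := by positivity
  have habs : |t / 2 ^ n| = |t| / 2 ^ n := by rw [abs_div, abs_of_pos hp]
  have h1 := hs (t / 2 ^ n) (by
    rw [habs, div_lt_iff₀ hp]
    rw [div_lt_iff₀ hδ] at hn
    linarith)
  have h2 := (abs_le.1 h1).2
  have h3 := iter n
  have h4 : 2 ^ n * (g (x + t / 2 ^ n) - g x - t / 2 ^ n * d - C * (t / 2 ^ n) ^ 2 / 2)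
      ≤ 2 ^ n * (ε / (|t| + 1) * |t / 2 ^ n|) := by
    apply mul_le_mul_of_nonneg_left _ hp.le
    have : 0 ≤ C * (t / 2 ^ n) ^ 2 / 2 := by positivity
    linarith
  have h5 : 2 ^ n * (ε / (|t| + 1) * |t / 2 ^ n|) ≤ ε := by
    rw [habs]
    have : 2 ^ n * (ε / (|t| + 1) * (|t| / 2 ^ n)) = ε * |t| / (|t| + 1) := by
      field_simp
    rw [this, div_le_iff₀ (by positivity)]
    nlinarith
  linarith

/-- If uniformly convergent functions are all semiconcave with a common constant,
then their derivatives converge at every common point of differentiability. -/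
theorem deriv_tendsto_of_tendstoUniformly_of_semiconcave
    (C : ℝ) (hC : 0 ≤ C) (u : ℕ → ℝ → ℝ) (v : ℝ → ℝ)
    (hu_cont : ∀ n, Continuous (u n)) (hv_cont : Continuous v)
    (hu_sc : ∀ (n : ℕ) (x h : ℝ), 0 < h →
      u n (x + h) + u n (x - h) - 2 * u n x ≤ C * h ^ 2)
    (hv_sc : ∀ (x h : ℝ), 0 < h → v (x + h) + v (x - h) - 2 * v x ≤ C * h ^ 2)
    (hunif : TendstoUniformly u v Filter.atTop)
    (x : ℝ) (hux : ∀ n, DifferentiableAt ℝ (u n) x)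
    (hvx : DifferentiableAt ℝ v x) :
    Filter.Tendsto (fun n => deriv (u n) x) Filter.atTop (nhds (deriv v x)) := by
  rw [Metric.tendsto_atTop]
  intro ε hε
  obtain ⟨δ, hδ, hs⟩ := small_of_hasDerivAt hvx.hasDerivAt (ε := ε / 5) (by positivity)
  obtain ⟨h, h0, hhδ, hhC⟩ : ∃ h : ℝ, 0 < h ∧ h < δ ∧ C * h / 2 ≤ ε / 5 := by
    refine ⟨min (δ / 2) (ε / 5 / (C + 1)), by positivity, ?_, ?_⟩
    · exact (min_le_left _ _).trans_lt (by linarith)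
    · have h1 : min (δ / 2) (ε / 5 / (C + 1)) ≤ ε / 5 / (C + 1) := min_le_right _ _
      have h2 : 0 < min (δ / 2) (ε / 5 / (C + 1)) := by positivity
      rw [le_div_iff₀ (by positivity)] at h1
      nlinarith
  have hev := Metric.tendstoUniformly_iff.1 hunif (ε / 5 * h) (by positivity)
  obtain ⟨N, hN⟩ := Filter.eventually_atTop.1 hev
  refine ⟨N, fun n hn => ?_⟩
  have hU := hN n hn
  simp only [Real.dist_eq] at hU ⊢
  have a0 := abs_lt.1 (hU x)
  have a1 := abs_lt.1 (hU (x + h))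
  have a2 := abs_lt.1 (hU (x + -h))
  have b1 := abs_le.1 (hs h (by rwa [abs_of_pos h0]))
  have b2 := abs_le.1 (hs (-h) (by rwa [abs_neg, abs_of_pos h0]))
  rw [abs_of_pos h0] at b1
  rw [abs_neg, abs_of_pos h0] at b2
  have c1 := upper_of_semiconcave hC (hu_sc n) (hux n).hasDerivAt h
  have c2 := upper_of_semiconcave hC (hu_sc n) (hux n).hasDerivAt (-h)
  have e : C * h ^ 2 / 2 ≤ ε / 5 * h := by nlinarith
  rw [neg_sq] at c2
  rw [abs_lt]
  constructor
  · refine lt_of_mul_lt_mul_right (a := h) ?_ h0.le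
    nlinarith
  · refine lt_of_mul_lt_mul_right (a := h) ?_ h0.le
    nlinarith
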